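/- arXiv:2112.11106 — 5 statements merged into one kernel-verified Lean document; each statement's English description precedes it below -/
import Mathlib

section
/- Let b̃ : ℝ^m → ℝ^m and σ : ℝ^m → ℝ^{m×d} be Lipschitz continuous, and let T > 0, M > 0, x ∈ ℝ^m. Then there exists a constant C > 0 (depending only on the Lipschitz constants of b̃ and σ, on |b̃(x)|, |σ(x)|, M and T) with the following property. Let f, g : [0,T] → ℝ^d be bounded measurable functions with |f_t| ≤ M and |g_t| ≤ M for all t; let λ : [0,T] → [0,T] be an absolutely continuous nondecreasing function with λ(0) = 0, λ(T) = T and ess sup_{s ∈ [0,T]} |λ'_s − 1| ≤ 1; and let φ, ψ : [0,T] → ℝ^m be continuous functions satisfying φ_t = x + ∫_0^t (b̃(φ_s) + σ(φ_s) f_s) ds and ψ_t = x + ∫_0^t (b̃(ψ_s) + σ(ψ_s) g_s) λ'_s ds for all t ∈ [0,T]. Then sup_{t ∈ [0,T]} |ψ_t − φ_t| ≤ C e^{CT} ( ess sup_{s ∈ [0,T]} |λ'_s − 1| + ∫_0^T |g_s − f_s| ds ). -/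
open MeasureTheory
open scoped NNReal

noncomputable section

/-- **Grönwall's inequality**, integral form, with a constant coefficient. -/
theorem le_mul_exp_of_le_add_integral {h : ℝ → ℝ} {T A K : ℝ} (hT : 0 ≤ T) (hK : 0 ≤ K)
    (hc : ContinuousOn h (Set.Icc 0 T)) (h0 : ∀ t ∈ Set.Icc 0 T, 0 ≤ h t)
    (hle : ∀ t ∈ Set.Icc 0 T, h t ≤ A + ∫ s in (0 : ℝ)..t, K * h s) :
    ∀ t ∈ Set.Icc 0 T, h t ≤ A * Real.exp (K * t) := by
  set H : ℝ → ℝ := Set.IccExtend hT (Set.domRestrict (Set.Icc 0 T) h) with hH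
  have hHc : Continuous H := hc.domRestrict.Icc_extend'
  have hHe : ∀ t ∈ Set.Icc 0 T, H t = h t := fun t ht => by
    simp [hH, Set.IccExtend_of_mem hT _ ht]
  have hI : ∀ t ∈ Set.Icc 0 T,
      ∫ s in (0 : ℝ)..t, K * h s = K * ∫ s in (0 : ℝ)..t, H s := fun t ht => by
    rw [← intervalIntegral.integral_const_mul]
    refine intervalIntegral.integral_congr fun s hs => ?_
    rw [Set.uIcc_of_le ht.1] at hs
    simp only [hHe s ⟨hs.1, hs.2.trans ht.2⟩]
  have hderiv : ∀ t, HasDerivAt (fun t => ∫ s in (0 : ℝ)..t, H s) (H t) t := fun t =>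
    hHc.integral_hasStrictDerivAt 0 t |>.hasDerivAt
  have hpos : ∀ t ∈ Set.Icc 0 T, 0 ≤ ∫ s in (0 : ℝ)..t, H s := fun t ht =>
    intervalIntegral.integral_nonneg ht.1 fun s hs => by
      have hs' : s ∈ Set.Icc 0 T := ⟨hs.1, hs.2.trans ht.2⟩
      rw [hHe s hs']
      exact h0 s hs'
  intro t ht
  have key := norm_le_gronwallBound_of_norm_deriv_right_le (δ := 0) (K := K) (ε := A)
    (f := fun t => ∫ s in (0 : ℝ)..t, H s) (f' := H) (a := 0) (b := T)
    (fun t _ => (hderiv t).continuousAt.continuousWithinAt)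
    (fun t _ => (hderiv t).hasDerivWithinAt) (by simp)
    (fun s hs => by
      have hs' : s ∈ Set.Icc 0 T := ⟨hs.1, hs.2.le⟩
      have := hle s hs'
      rw [hI s hs'] at this
      rw [Real.norm_of_nonneg (hpos s hs'), hHe s hs', Real.norm_of_nonneg (h0 s hs')]
      linarith) t ht
  rw [Real.norm_of_nonneg (hpos t ht), sub_zero] at key
  have h1 := hle t ht
  rw [hI t ht] at h1
  rcases hK.eq_or_lt with rfl | hK'
  · simpa using h1
  · rw [gronwallBound_of_K_ne_0 hK'.ne'] at key
    have h2 := mul_le_mul_of_nonneg_left key hK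
    have h3 : K * (0 * Real.exp (K * t) + A / K * (Real.exp (K * t) - 1))
        = A * Real.exp (K * t) - A := by field_simp; ring
    linarith

section ControlledDrift

variable {E F : Type*} [NormedAddCommGroup E] [NormedSpace ℝ E]
  [NormedAddCommGroup F] [NormedSpace ℝ F] {b : E → E} {σ : E → F →L[ℝ] E} {Kb Kσ : ℝ≥0}

theorem norm_drift_sub_le (hb : LipschitzWith Kb b) (hσ : LipschitzWith Kσ σ) {M : ℝ} (y z : E)
    {u : F} (hu : ‖u‖ ≤ M) :
    ‖(b y - b z) + (σ y - σ z) u‖ ≤ (Kb + Kσ * M) * ‖y - z‖ := by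
  have h1 := hb.norm_sub_le y z
  have h2 := hσ.norm_sub_le y z
  have h3 : ‖(σ y - σ z) u‖ ≤ Kσ * ‖y - z‖ * M :=
    (ContinuousLinearMap.le_opNorm _ _).trans (by gcongr)
  calc _ ≤ ‖b y - b z‖ + ‖(σ y - σ z) u‖ := norm_add_le _ _
    _ ≤ Kb * ‖y - z‖ + Kσ * ‖y - z‖ * M := add_le_add h1 h3
    _ = _ := by ring

theorem norm_drift_le (hb : LipschitzWith Kb b) (hσ : LipschitzWith Kσ σ) {M : ℝ} (x y : E)
    {u : F} (hu : ‖u‖ ≤ M) :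
    ‖b y + σ y u‖ ≤ (‖b x‖ + ‖σ x‖ * M) + (Kb + Kσ * M) * ‖y - x‖ := by
  have h1 := norm_drift_sub_le hb hσ y x hu
  have h2 : ‖σ x u‖ ≤ ‖σ x‖ * M := (ContinuousLinearMap.le_opNorm _ _).trans (by gcongr)
  calc ‖b y + σ y u‖ = ‖(b x + σ x u) + ((b y - b x) + (σ y - σ x) u)‖ := by
        congr 1
        simp only [sub_apply]
        abel
    _ ≤ ‖b x‖ + ‖σ x u‖ + ‖(b y - b x) + (σ y - σ x) u‖ :=
        (norm_add_le _ _).trans (by gcongr; exact norm_add_le _ _)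
    _ ≤ _ := by linarith

theorem aestronglyMeasurable_drift (hb : Continuous b) (hσ : Continuous σ) {T : ℝ}
    {φ : ℝ → E} (hφ : ContinuousOn φ (Set.Icc 0 T)) {f : ℝ → F}
    (hf : AEStronglyMeasurable f (volume.restrict (Set.Icc 0 T))) :
    AEStronglyMeasurable (fun s => b (φ s) + σ (φ s) (f s))
      (volume.restrict (Set.Icc 0 T)) :=
  ((hb.comp_continuousOn hφ).aestronglyMeasurable measurableSet_Icc).add
    (isBoundedBilinearMap_apply.continuous.comp_aestronglyMeasurable
      (((hσ.comp_continuousOn hφ).aestronglyMeasurable measurableSet_Icc).prodMk hf))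

theorem integrableOn_smul_drift (hb : LipschitzWith Kb b) (hσ : LipschitzWith Kσ σ) {T M c : ℝ}
    {φ : ℝ → E} (hφ : ContinuousOn φ (Set.Icc 0 T)) {f : ℝ → F}
    (hf : AEStronglyMeasurable f (volume.restrict (Set.Icc 0 T)))
    (hfM : ∀ t ∈ Set.Icc 0 T, ‖f t‖ ≤ M) {w : ℝ → ℝ}
    (hw : AEStronglyMeasurable w (volume.restrict (Set.Icc 0 T)))
    (hwc : ∀ᵐ s ∂(volume.restrict (Set.Icc 0 T)), |w s| ≤ c) :
    IntegrableOn (fun s => w s • (b (φ s) + σ (φ s) (f s))) (Set.Icc 0 T) := by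
  have hdom : ContinuousOn (fun s => c * ((‖b 0‖ + ‖σ 0‖ * M) + (Kb + Kσ * M) * ‖φ s - 0‖))
      (Set.Icc 0 T) := by fun_prop
  refine (hdom.integrableOn_Icc).mono'
    (hw.smul (aestronglyMeasurable_drift hb.continuous hσ.continuous hφ hf)) ?_
  filter_upwards [hwc, ae_restrict_mem measurableSet_Icc] with s hs hsI
  rw [norm_smul]
  exact mul_le_mul hs (norm_drift_le hb hσ 0 (φ s) (hfM s hsI)) (norm_nonneg _)
    ((abs_nonneg _).trans hs)

/-- A priori bound for solutions of the controlled equation. -/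
theorem norm_sub_le_of_eq_add_integral_drift (hb : LipschitzWith Kb b) (hσ : LipschitzWith Kσ σ)
    {T M : ℝ} (hT : 0 ≤ T) (hM : 0 ≤ M) {x : E} {φ : ℝ → E}
    (hφ : ContinuousOn φ (Set.Icc 0 T)) {f : ℝ → F} (hfM : ∀ t ∈ Set.Icc 0 T, ‖f t‖ ≤ M)
    (heq : ∀ t ∈ Set.Icc 0 T, φ t = x + ∫ s in (0 : ℝ)..t, (b (φ s) + σ (φ s) (f s))) :
    ∀ t ∈ Set.Icc 0 T,
      ‖φ t - x‖ ≤ (‖b x‖ + ‖σ x‖ * M) * T * Real.exp ((Kb + Kσ * M) * T) := by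
  have hL : 0 ≤ (Kb + Kσ * M : ℝ) := by positivity
  intro t ht
  refine (le_mul_exp_of_le_add_integral (h := fun t => ‖φ t - x‖) hT hL (by fun_prop)
    (fun _ _ => norm_nonneg _) (A := (‖b x‖ + ‖σ x‖ * M) * T) ?_ t ht).trans
    (by gcongr; exact ht.2)
  intro t ht
  have hint : IntervalIntegrable (fun s => (Kb + Kσ * M) * ‖φ s - x‖) volume 0 t :=
    ContinuousOn.intervalIntegrable_of_Icc ht.1
      (ContinuousOn.mono (by fun_prop) (Set.Icc_subset_Icc_right ht.2))
  have h1 : φ t - x = ∫ s in (0 : ℝ)..t, (b (φ s) + σ (φ s) (f s)) := by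
    rw [heq t ht, add_sub_cancel_left]
  calc ‖φ t - x‖
      ≤ ∫ s in (0 : ℝ)..t, ((‖b x‖ + ‖σ x‖ * M) + (Kb + Kσ * M) * ‖φ s - x‖) := by
        rw [h1]
        refine intervalIntegral.norm_integral_le_of_norm_le ht.1
          (Filter.Eventually.of_forall fun s hs => ?_)
          (intervalIntegrable_const.add hint)
        exact norm_drift_le hb hσ x (φ s) (hfM s ⟨hs.1.le, hs.2.trans ht.2⟩)
    _ = (‖b x‖ + ‖σ x‖ * M) * t + ∫ s in (0 : ℝ)..t, (Kb + Kσ * M) * ‖φ s - x‖ := by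
        rw [intervalIntegral.integral_add intervalIntegrable_const hint,
          intervalIntegral.integral_const, smul_eq_mul]
        ring
    _ ≤ _ := by gcongr; exact ht.2

theorem norm_smul_drift_sub_drift_le (hb : LipschitzWith Kb b) (hσ : LipschitzWith Kσ σ)
    {M D R : ℝ} {x y z : E} {u v : F} {a : ℝ} (hM : 0 ≤ M) (hR : ‖z - x‖ ≤ R) (hu : ‖u‖ ≤ M)
    (hv : ‖v‖ ≤ M) (ha : |a - 1| ≤ D) (hD : D ≤ 1) :
    ‖a • (b y + σ y v) - (b z + σ z u)‖ ≤
      2 * (Kb + Kσ * M) * ‖y - z‖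
        + (D * ((‖b x‖ + ‖σ x‖ * M) + (Kb + Kσ * M) * R)
          + 2 * (‖σ x‖ + Kσ * R) * ‖v - u‖) := by
  have ha2 : |a| ≤ 2 := by
    have := abs_le.mp (ha.trans hD)
    exact abs_le.mpr ⟨by linarith, by linarith⟩
  have hR0 : 0 ≤ R := (norm_nonneg _).trans hR
  have hD0 : 0 ≤ D := (abs_nonneg _).trans ha
  have hσz : ‖σ z‖ ≤ ‖σ x‖ + Kσ * R := by
    have h1 := hσ.norm_sub_le z x
    have h2 : (Kσ : ℝ) * ‖z - x‖ ≤ Kσ * R := by gcongr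
    have h3 := norm_le_norm_add_norm_sub (σ x) (σ z)
    rw [norm_sub_rev] at h3
    linarith
  have hdecomp : a • (b y + σ y v) - (b z + σ z u)
      = a • ((b y - b z) + (σ y - σ z) v) + ((a - 1) • (b z + σ z u) + a • σ z (v - u)) := by
    simp only [sub_apply, map_sub]
    module
  have e1 : ‖a • ((b y - b z) + (σ y - σ z) v)‖ ≤ 2 * ((Kb + Kσ * M) * ‖y - z‖) := by
    rw [norm_smul]
    exact mul_le_mul ha2 (norm_drift_sub_le hb hσ y z hv) (norm_nonneg _) zero_le_two
  have e2 : ‖(a - 1) • (b z + σ z u)‖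
      ≤ D * ((‖b x‖ + ‖σ x‖ * M) + (Kb + Kσ * M) * R) := by
    rw [norm_smul]
    refine mul_le_mul ha ((norm_drift_le hb hσ x z hu).trans ?_) (norm_nonneg _) hD0
    gcongr
  have e3 : ‖a • σ z (v - u)‖ ≤ 2 * ((‖σ x‖ + Kσ * R) * ‖v - u‖) := by
    rw [norm_smul]
    refine mul_le_mul ha2 ((ContinuousLinearMap.le_opNorm _ _).trans ?_) (norm_nonneg _)
      zero_le_two
    gcongr
  rw [hdecomp]
  have e4 := norm_add_le (a • ((b y - b z) + (σ y - σ z) v))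
    ((a - 1) • (b z + σ z u) + a • σ z (v - u))
  have e5 := norm_add_le ((a - 1) • (b z + σ z u)) (a • σ z (v - u))
  linarith

end ControlledDrift

theorem statement_8 {d m : ℕ}
    (btilde : EuclideanSpace ℝ (Fin m) → EuclideanSpace ℝ (Fin m))
    (σ : EuclideanSpace ℝ (Fin m) → (EuclideanSpace ℝ (Fin d) →L[ℝ] EuclideanSpace ℝ (Fin m)))
    (Kb Kσ : ℝ≥0) (hb : LipschitzWith Kb btilde) (hσ : LipschitzWith Kσ σ)
    (T M : ℝ) (hT : 0 < T) (hM : 0 < M) (x : EuclideanSpace ℝ (Fin m)) :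
    ∃ C : ℝ, 0 < C ∧
      ∀ (f g : ℝ → EuclideanSpace ℝ (Fin d)),
        Measurable f → Measurable g →
        (∀ t ∈ Set.Icc (0 : ℝ) T, ‖f t‖ ≤ M) →
        (∀ t ∈ Set.Icc (0 : ℝ) T, ‖g t‖ ≤ M) →
        ∀ (lam lam' : ℝ → ℝ),
          -- λ is absolutely continuous with (a.e.) derivative λ', nondecreasing,
          -- λ(0) = 0, λ(T) = T
          IntegrableOn lam' (Set.Icc 0 T) →
          (∀ t ∈ Set.Icc (0 : ℝ) T, lam t = ∫ s in (0 : ℝ)..t, lam' s) →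
          MonotoneOn lam (Set.Icc 0 T) →
          lam 0 = 0 → lam T = T →
          -- D is an a.e. bound for |λ' - 1| on [0,T] (in particular any D with
          -- essSup |λ' - 1| ≤ D ≤ 1 works), with ess sup |λ' - 1| ≤ 1
          ∀ D : ℝ, D ≤ 1 →
            (∀ᵐ s ∂(volume.restrict (Set.Icc (0 : ℝ) T)), |lam' s - 1| ≤ D) →
            ∀ (φ ψ : ℝ → EuclideanSpace ℝ (Fin m)),
              ContinuousOn φ (Set.Icc 0 T) → ContinuousOn ψ (Set.Icc 0 T) →
              (∀ t ∈ Set.Icc (0 : ℝ) T,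
                φ t = x + ∫ s in (0 : ℝ)..t, (btilde (φ s) + σ (φ s) (f s))) →
              (∀ t ∈ Set.Icc (0 : ℝ) T,
                ψ t = x + ∫ s in (0 : ℝ)..t,
                  lam' s • (btilde (ψ s) + σ (ψ s) (g s))) →
              ∀ t ∈ Set.Icc (0 : ℝ) T,
                ‖ψ t - φ t‖ ≤
                  C * Real.exp (C * T) * (D + ∫ s in (0 : ℝ)..T, ‖g s - f s‖) := by
  set L : ℝ := Kb + Kσ * M with hLdef
  set B : ℝ := ‖btilde x‖ + ‖σ x‖ * M with hBdef
  set R : ℝ := B * T * Real.exp (L * T) with hRdef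
  set N : ℝ := B + L * R with hNdef
  set S : ℝ := ‖σ x‖ + Kσ * R with hSdef
  have hL : 0 ≤ L := by positivity
  have hB : 0 ≤ B := by positivity
  have hR : 0 ≤ R := by positivity
  have hN : 0 ≤ N := by positivity
  have hS : 0 ≤ S := by positivity
  refine ⟨1 + 2 * L + N * T + 2 * S, by positivity, ?_⟩
  intro f g hf hg hfM hgM lam lam' hlam' _ _ _ _ D hD1 hD φ ψ hφ hψ hφeq hψeq
  have hD0 : 0 ≤ D := by
    have : (ae (volume.restrict (Set.Icc (0 : ℝ) T))).NeBot := by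
      rw [ae_neBot, Ne, Measure.restrict_eq_zero, Real.volume_Icc]
      simpa using hT
    obtain ⟨s, hs⟩ := hD.exists
    exact (abs_nonneg _).trans hs
  have hφx := norm_sub_le_of_eq_add_integral_drift hb hσ hT.le hM.le hφ hfM hφeq
  have hlam2 : ∀ᵐ s ∂(volume.restrict (Set.Icc (0 : ℝ) T)), |lam' s| ≤ 2 := by
    filter_upwards [hD] with s hs
    have := abs_le.mp (hs.trans hD1)
    exact abs_le.mpr ⟨by linarith, by linarith⟩
  have hψint := integrableOn_smul_drift hb hσ hψ hg.aestronglyMeasurable hgM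
    hlam'.aestronglyMeasurable hlam2
  have hφint : IntegrableOn (fun s => btilde (φ s) + σ (φ s) (f s)) (Set.Icc 0 T) := by
    simpa using integrableOn_smul_drift (c := 1) (w := fun _ => 1) hb hσ hφ
      hf.aestronglyMeasurable hfM aestronglyMeasurable_const (by simp)
  have hgfint : IntegrableOn (fun s => ‖g s - f s‖) (Set.Icc 0 T) := by
    refine Integrable.mono' (g := fun _ => M + M) (integrable_const _)
      (hg.sub hf).norm.aestronglyMeasurable ?_
    filter_upwards [ae_restrict_mem measurableSet_Icc] with s hs
    rw [norm_norm]
    exact (norm_sub_le _ _).trans (add_le_add (hgM s hs) (hfM s hs))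
  have hII : ∀ {G : Type} [NormedAddCommGroup G] {F : ℝ → G},
      IntegrableOn F (Set.Icc 0 T) → ∀ t ∈ Set.Icc 0 T, IntervalIntegrable F volume 0 t :=
    fun hF t ht => (hF.mono_set
      (by rw [Set.uIcc_of_le ht.1]; exact Set.Icc_subset_Icc_right ht.2)).intervalIntegrable
  have hdiff : ContinuousOn (fun s => ‖ψ s - φ s‖) (Set.Icc 0 T) := (hψ.sub hφ).norm
  set I : ℝ := ∫ s in (0 : ℝ)..T, ‖g s - f s‖ with hIdef
  have hI : 0 ≤ I := intervalIntegral.integral_nonneg hT.le fun _ _ => norm_nonneg _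
  intro t ht
  have hgron := le_mul_exp_of_le_add_integral (h := fun s => ‖ψ s - φ s‖) hT.le
    (K := 2 * L) (by positivity) hdiff (fun _ _ => norm_nonneg _)
    (A := D * N * T + 2 * S * I) (fun t ht => by
      have i1 := hII (hdiff.integrableOn_Icc.const_mul (2 * L)) t ht
      have i2 := hII (hgfint.const_mul (2 * S)) t ht
      have hIt : ∫ s in (0 : ℝ)..t, ‖g s - f s‖ ≤ I :=
        intervalIntegral.integral_mono_interval le_rfl ht.1 ht.2
          (Filter.Eventually.of_forall fun _ => norm_nonneg _)
          (hII hgfint T ⟨hT.le, le_rfl⟩)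
      calc ‖ψ t - φ t‖
          ≤ ∫ s in (0 : ℝ)..t, (2 * L * ‖ψ s - φ s‖ + (D * N + 2 * S * ‖g s - f s‖)) := by
            rw [hψeq t ht, hφeq t ht, add_sub_add_left_eq_sub,
              ← intervalIntegral.integral_sub (hII hψint t ht) (hII hφint t ht)]
            refine intervalIntegral.norm_integral_le_of_norm_le ht.1 ?_
              (i1.add (intervalIntegrable_const.add i2))
            rw [ae_restrict_iff' measurableSet_Icc] at hD
            filter_upwards [hD] with s hDs hs
            have hs' : s ∈ Set.Icc 0 T := ⟨hs.1.le, hs.2.trans ht.2⟩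
            exact norm_smul_drift_sub_drift_le hb hσ hM.le (hφx s hs') (hfM s hs') (hgM s hs')
              (hDs hs') hD1
        _ = D * N * t + 2 * S * (∫ s in (0 : ℝ)..t, ‖g s - f s‖)
              + ∫ s in (0 : ℝ)..t, 2 * L * ‖ψ s - φ s‖ := by
            rw [intervalIntegral.integral_add i1 (intervalIntegrable_const.add i2),
              intervalIntegral.integral_add intervalIntegrable_const i2,
              intervalIntegral.integral_const, intervalIntegral.integral_const_mul (2 * S),
              smul_eq_mul]
            ring
        _ ≤ _ := by gcongr; exact ht.2) t ht
  have hC1 : D * N * T + 2 * S * I ≤ (1 + 2 * L + N * T + 2 * S) * (D + I) := by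
    have h1 : 0 ≤ (1 + 2 * L + 2 * S) * D := by positivity
    have h2 : 0 ≤ (1 + 2 * L + N * T) * I := by positivity
    linarith
  have hC2 : Real.exp (2 * L * t) ≤ Real.exp ((1 + 2 * L + N * T + 2 * S) * T) := by
    have h1 : 2 * L ≤ 1 + 2 * L + N * T + 2 * S := by
      have : 0 ≤ N * T := by positivity
      linarith
    exact Real.exp_le_exp.mpr (mul_le_mul h1 ht.2 ht.1 (by positivity))
  calc ‖ψ t - φ t‖ ≤ (D * N * T + 2 * S * I) * Real.exp (2 * L * t) := hgron
    _ ≤ (1 + 2 * L + N * T + 2 * S) * (D + I)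
          * Real.exp ((1 + 2 * L + N * T + 2 * S) * T) := by gcongr
    _ = _ := by ring
end
end

section
/- Let μ be a Borel measure on ℝ^d, η > 0 with μ({u : |u| > η}) < ∞, and let c : ℝ^m × ℝ^d → ℝ^m be jointly measurable and such that for every u ∈ ℝ^d the map x ↦ c(x,u) is continuous. Fix y ∈ ℝ^m, γ > 0 and x₀ ∈ ℝ^m, and assume μ({u : |u| > η, |x₀ + c(x₀, u) − y| < γ}) > 0. Then there exists γ' > n0, i.e. γ' > 0, such that inf_{x : |x − x₀| ≤ 2γ'} μ({u : |u| > η, |x + c(x, u) − y| < γ}) > 0. -/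
open MeasureTheory

noncomputable section

theorem statement_10 {d m : ℕ} (μ : Measure (EuclideanSpace ℝ (Fin d)))
    (η : ℝ) (hη : 0 < η) (hfin : μ {u | η < ‖u‖} < ⊤)
    (c : EuclideanSpace ℝ (Fin m) → EuclideanSpace ℝ (Fin d) → EuclideanSpace ℝ (Fin m))
    (hcmeas : Measurable (fun p : EuclideanSpace ℝ (Fin m) × EuclideanSpace ℝ (Fin d) =>
      c p.1 p.2))
    (hccont : ∀ u, Continuous fun x => c x u)
    (y : EuclideanSpace ℝ (Fin m)) (γ : ℝ) (hγ : 0 < γ)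
    (x₀ : EuclideanSpace ℝ (Fin m))
    (hpos : 0 < μ {u | η < ‖u‖ ∧ ‖x₀ + c x₀ u - y‖ < γ}) :
    ∃ γ' > (0 : ℝ),
      0 < ⨅ x ∈ Metric.closedBall x₀ (2 * γ'),
        μ {u | η < ‖u‖ ∧ ‖x + c x u - y‖ < γ} := by
  let A : ℕ → Set (EuclideanSpace ℝ (Fin d)) := fun n =>
    {u | η < ‖u‖ ∧ ∀ x ∈ Metric.closedBall x₀ (2 * (1 / ((n : ℝ) + 1))), ‖x + c x u - y‖ < γ}
  have hsub : {u | η < ‖u‖ ∧ ‖x₀ + c x₀ u - y‖ < γ} ⊆ ⋃ n, A n := by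
    rintro u ⟨hu, hlt⟩
    have hcont : Continuous fun x => ‖x + c x u - y‖ :=
      ((continuous_id.add (hccont u)).sub continuous_const).norm
    obtain ⟨ε, hε, hball⟩ := Metric.isOpen_iff.mp (isOpen_lt hcont continuous_const) x₀ hlt
    obtain ⟨n, hn⟩ := exists_nat_one_div_lt (half_pos hε)
    refine Set.mem_iUnion.mpr ⟨n, hu, fun x hx => hball ?_⟩
    exact Metric.closedBall_subset_ball (by linarith) hx
  obtain ⟨n, hn⟩ := exists_measure_pos_of_not_measure_iUnion_null
    (hpos.trans_le (measure_mono hsub)).ne'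
  refine ⟨1 / ((n : ℝ) + 1), Nat.one_div_pos_of_nat, hn.trans_le ?_⟩
  exact le_iInf₂ fun x hx => measure_mono fun u hu => ⟨hu.1, hu.2 x hx⟩
end
end

section
/- Let b̃ : ℝ^m → ℝ^m and σ : ℝ^m → ℝ^{m×d} be Lipschitz continuous, and assume that for every x ∈ ℝ^m the linear map σ(x) : ℝ^d → ℝ^m is surjective (i.e. rank σ(x) = m ≤ d). Then for every x, y ∈ ℝ^m, every T > 0 and every ε > 0 there exists a step function f : [0,T] → ℝ^d (piecewise constant on a finite partition of [0,T]) such that the unique solution φ of the ODE φ_t = x + ∫_0^t (b̃(φ_s) + σ(φ_s) f_s) ds on [0,T] satisfies sup_{t ∈ [0,T]} |φ_t − (x + (t/T)(y − x))| < ε; in particular |φ_T − y| < ε. -/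
open MeasureTheory
open scoped NNReal

noncomputable section

/-- `f` is a step function on `[0, T]`: there is a partition
`[0,T] = [0,τ₁) ∪ [τ₁,τ₂) ∪ … ∪ [τ_{n-1}, T]` on whose intervals `f` is constant. -/
def IsStepOn {E : Type*} (f : ℝ → E) (T : ℝ) : Prop :=
  ∃ (n : ℕ) (τ : ℕ → ℝ), 0 < n ∧ τ 0 = 0 ∧ τ n = T ∧
    (∀ i < n, τ i < τ (i + 1)) ∧
    (∀ i < n, ∀ s ∈ Set.Ico (τ i) (τ (i + 1)), f s = f (τ i)) ∧
    f T = f (τ (n - 1))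

open Set Filter Topology in
/-- A vector field with Lipschitz constant `K` can be integrated from any starting point over every
interval of length at most `1 / (2 * K)`. -/
theorem LipschitzWith.exists_hasDerivWithinAt_Icc {E : Type*} [NormedAddCommGroup E]
    [NormedSpace ℝ E] [CompleteSpace E] {g : E → E} {K : ℝ≥0} (hg : LipschitzWith K g) (z : E)
    {a b : ℝ} (hab : a ≤ b) (hK : 2 * K * (b - a) ≤ 1) :
    ∃ α : ℝ → E, α a = z ∧ ∀ t ∈ Icc a b, HasDerivWithinAt α (g (α t)) (Icc a b) t := by
  have hba : 0 ≤ b - a := sub_nonneg.2 hab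
  let A : ℝ≥0 := 2 * ‖g z‖₊ * (b - a).toNNReal
  have hA : (A : ℝ) = 2 * ‖g z‖ * (b - a) := by simp [A, Real.coe_toNNReal _ hba]
  have hPL : IsPicardLindelof (fun _ => g) (⟨a, left_mem_Icc.2 hab⟩ : Icc a b) z A 0
      (‖g z‖₊ + K * A) K := by
    refine IsPicardLindelof.of_time_independent (fun u hu => ?_) hg.lipschitzOnWith ?_
    · have h1 : ‖g u - g z‖ ≤ K * A := by
        rw [← dist_eq_norm]
        exact (hg.dist_le_mul u z).trans
          (mul_le_mul_of_nonneg_left (Metric.mem_closedBall.1 hu) K.2)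
      have h2 := norm_add_le (g z) (g u - g z)
      rw [add_sub_cancel] at h2
      push_cast
      linarith
    · push_cast
      rw [sub_self, max_eq_left hba, sub_zero]
      have := mul_le_mul_of_nonneg_right hK A.2
      change 2 * (K : ℝ) * (b - a) * (A : ℝ) ≤ 1 * (A : ℝ) at this
      nlinarith
  exact hPL.exists_eq_forall_mem_Icc_hasDerivWithinAt₀

open Set Filter Topology in
/-- Gluing: an ODE whose right-hand side is Lipschitz in space and piecewise constant in time, on
a uniform mesh, has a solution on every finite union of mesh intervals. -/
theorem exists_hasDerivWithinAt_Ici_of_piecewise_const {E : Type*} [NormedAddCommGroup E]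
    [NormedSpace ℝ E] [CompleteSpace E] {F : ℝ → E → E} {K : ℝ≥0}
    (hF : ∀ t, LipschitzWith K (F t)) {h : ℝ} (hh : 0 ≤ h) (hK : 2 * K * h ≤ 1)
    (hconst : ∀ k : ℕ, ∀ t ∈ Ico (k * h) ((k + 1) * h), F t = F (k * h)) (x : E) (n : ℕ) :
    ∃ φ : ℝ → E, φ 0 = x ∧ ContinuousOn φ (Icc 0 (n * h)) ∧
      ∀ t ∈ Ico 0 (n * h), HasDerivWithinAt φ (F t (φ t)) (Ici t) t := by
  induction n with
  | zero => exact ⟨fun _ => x, rfl, continuousOn_const, by simp⟩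
  | succ k ih =>
    obtain ⟨φ, hφ0, hφc, hφd⟩ := ih
    push_cast
    set c : ℝ := k * h with hc
    have hc0 : 0 ≤ c := by positivity
    have hd : (k + 1) * h = c + h := by rw [hc]; ring
    rw [hd]
    obtain ⟨ψ, hψ0, hψd⟩ := (hF c).exists_hasDerivWithinAt_Icc (φ c)
      (show c ≤ c + h by linarith) (by simpa using hK)
    let χ : ℝ → E := fun t => if t < c then φ t else ψ t
    have hχφ : EqOn χ φ (Icc 0 c) := by
      intro t ht
      rcases ht.2.lt_or_eq with h' | h'
      · simp [χ, h']
      · simp [χ, h', hψ0]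
    have hχψ : EqOn χ ψ (Ici c) := fun t ht => if_neg (not_lt.2 ht)
    refine ⟨χ, (hχφ (left_mem_Icc.2 hc0)).trans hφ0, ?_, ?_⟩
    · rw [← Icc_union_Icc_eq_Icc hc0 (show c ≤ c + h by linarith)]
      have hψc : ContinuousOn ψ (Icc c (c + h)) := fun t ht => (hψd t ht).continuousWithinAt
      exact (hφc.congr hχφ).union_of_isClosed
        (hψc.congr (hχψ.mono Icc_subset_Ici_self)) isClosed_Icc isClosed_Icc
    · intro t ht
      rcases lt_or_ge t c with htc | htc
      · rw [hχφ ⟨ht.1, htc.le⟩]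
        refine (hφd t ⟨ht.1, htc⟩).congr_of_eventuallyEq ?_ (hχφ ⟨ht.1, htc.le⟩)
        filter_upwards [mem_nhdsWithin_of_mem_nhds (Iio_mem_nhds htc)] with s hs
        exact if_pos hs
      · rw [hχψ htc, hconst k t ⟨htc, by rw [hd]; exact ht.2⟩]
        refine HasDerivWithinAt.congr ?_ (fun s hs => hχψ (htc.trans hs)) (hχψ htc)
        exact (hψd t ⟨htc, ht.2.le⟩).mono_of_mem_nhdsWithin
          (mem_of_superset (Icc_mem_nhdsGE ht.2) (Icc_subset_Icc_left htc))

/-- A surjective operator onto a finite-dimensional space has invertible Gram operator. -/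
theorem ContinuousLinearMap.isUnit_self_comp_adjoint {E F : Type*} [NormedAddCommGroup E]
    [InnerProductSpace ℝ E] [FiniteDimensional ℝ E] [NormedAddCommGroup F]
    [InnerProductSpace ℝ F] [FiniteDimensional ℝ F] [CompleteSpace E] [CompleteSpace F]
    (A : E →L[ℝ] F) (hA : Function.Surjective A) :
    IsUnit (A ∘L ContinuousLinearMap.adjoint A) := by
  rw [ContinuousLinearMap.isUnit_iff_isUnit_toLinearMap, LinearMap.isUnit_iff_ker_eq_bot]
  rw [ContinuousLinearMap.ker_self_comp_adjoint, ← ContinuousLinearMap.orthogonal_range,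
    LinearMap.range_eq_top.2 hA, Submodule.top_orthogonal_eq_bot]

/-- A continuous family of surjective operators between finite-dimensional inner product spaces
can be solved continuously. -/
theorem exists_continuous_apply_eq_of_surjective {X E F : Type*} [TopologicalSpace X]
    [NormedAddCommGroup E] [InnerProductSpace ℝ E] [FiniteDimensional ℝ E]
    [NormedAddCommGroup F] [InnerProductSpace ℝ F] [FiniteDimensional ℝ F]
    {A : X → E →L[ℝ] F} (hA : Continuous A) (hsurj : ∀ p, Function.Surjective (A p))
    {v : X → F} (hv : Continuous v) :
    ∃ w : X → E, Continuous w ∧ ∀ p, A p (w p) = v p := by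
  have : CompleteSpace E := FiniteDimensional.complete ℝ E
  have : CompleteSpace F := FiniteDimensional.complete ℝ F
  have hAdj : Continuous fun p => ContinuousLinearMap.adjoint (A p) :=
    ContinuousLinearMap.adjoint.continuous.comp hA
  have hinv : Continuous fun p =>
      Ring.inverse (A p ∘L ContinuousLinearMap.adjoint (A p)) := by
    refine continuous_iff_continuousAt.2 fun p => ?_
    obtain ⟨U, hU⟩ := (A p).isUnit_self_comp_adjoint (hsurj p)
    have h1 := NormedRing.inverse_continuousAt U
    rw [hU] at h1
    exact ContinuousAt.comp (f := fun p => A p ∘L ContinuousLinearMap.adjoint (A p)) h1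
      (hA.clm_comp hAdj).continuousAt
  refine ⟨fun p => ContinuousLinearMap.adjoint (A p)
    (Ring.inverse (A p ∘L ContinuousLinearMap.adjoint (A p)) (v p)),
    hAdj.clm_apply (hinv.clm_apply hv), fun p => ?_⟩
  have h2 := Ring.mul_inverse_cancel _ ((A p).isUnit_self_comp_adjoint (hsurj p))
  exact DFunLike.congr_fun h2 (v p)

open Set in
/-- Sampling at the left end of `n` equal pieces gives a step function. -/
theorem isStepOn_comp_floor {E : Type*} (w : ℕ → E) {h : ℝ} (hh : 0 < h) {n : ℕ} (hn : 0 < n) :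
    IsStepOn (fun t => w (min ⌊t / h⌋₊ (n - 1))) (n * h) := by
  refine ⟨n, fun i => i * h, hn, by simp, rfl, fun i _ => ?_, fun i _ s hs => ?_, ?_⟩
  · push_cast
    nlinarith
  · have h1 : ⌊s / h⌋₊ = i := by
      rw [Nat.floor_eq_iff (div_nonneg ((by positivity : (0 : ℝ) ≤ i * h).trans hs.1) hh.le)]
      refine ⟨(le_div_iff₀ hh).2 hs.1, (div_lt_iff₀ hh).2 ?_⟩
      have := hs.2
      push_cast at this
      exact this
    simp [h1, hh.ne']
  · simp [hh.ne']

theorem statement_11 {d m : ℕ}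
    (btilde : EuclideanSpace ℝ (Fin m) → EuclideanSpace ℝ (Fin m))
    (σ : EuclideanSpace ℝ (Fin m) → (EuclideanSpace ℝ (Fin d) →L[ℝ] EuclideanSpace ℝ (Fin m)))
    (Kb Kσ : ℝ≥0) (hb : LipschitzWith Kb btilde) (hσ : LipschitzWith Kσ σ)
    (hσsurj : ∀ x, Function.Surjective (σ x)) :
    ∀ (x y : EuclideanSpace ℝ (Fin m)) (T ε : ℝ), 0 < T → 0 < ε →
      ∃ f : ℝ → EuclideanSpace ℝ (Fin d), IsStepOn f T ∧
        ∃ φ : ℝ → EuclideanSpace ℝ (Fin m),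
          ContinuousOn φ (Set.Icc 0 T) ∧
          (∀ t ∈ Set.Icc (0 : ℝ) T,
            φ t = x + ∫ s in (0 : ℝ)..t, (btilde (φ s) + σ (φ s) (f s))) ∧
          (∀ t ∈ Set.Icc (0 : ℝ) T,
            ‖φ t - (x + (t / T) • (y - x))‖ < ε) := by
  intro x y T ε hT hε
  let ℓ : ℝ → EuclideanSpace ℝ (Fin m) := fun t => x + (t / T) • (y - x)
  have hℓc : Continuous ℓ := by fun_prop
  have hℓd : ∀ t, HasDerivAt ℓ (T⁻¹ • (y - x)) t := fun t => by
    simpa [ℓ] using ((((hasDerivAt_id t).div_const T).smul_const (y - x)).const_add x)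
  obtain ⟨w, hwc, hw⟩ := exists_continuous_apply_eq_of_surjective
    (hσ.continuous.comp hℓc) (fun t => hσsurj (ℓ t))
    (v := fun t => T⁻¹ • (y - x) - btilde (ℓ t)) (by have := hb.continuous; fun_prop)
  obtain ⟨M, hM⟩ := isCompact_Icc.exists_bound_of_continuousOn
    (hwc.continuousOn (s := Set.Icc 0 T))
  obtain ⟨S, hS⟩ := isCompact_Icc.exists_bound_of_continuousOn
    ((hσ.continuous.comp hℓc).continuousOn (s := Set.Icc 0 T))
  have hM0 : 0 ≤ M := (norm_nonneg _).trans (hM 0 ⟨le_rfl, hT.le⟩)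
  have hS0 : 0 ≤ S := (norm_nonneg _).trans (hS 0 ⟨le_rfl, hT.le⟩)
  let K : ℝ≥0 := Kb + Kσ * M.toNNReal
  obtain ⟨η, hη, hηε⟩ : ∃ η > 0, gronwallBound 0 K η T < ε := by
    have h1 := (gronwallBound_continuous_ε 0 K T).tendsto 0
    rw [gronwallBound_ε0_δ0] at h1
    have h2 := ((h1.eventually_lt_const hε).filter_mono nhdsWithin_le_nhds).and
      (self_mem_nhdsWithin (s := Set.Ioi (0 : ℝ)))
    obtain ⟨η, h3, h4⟩ := h2.exists
    exact ⟨η, h4, h3⟩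
  obtain ⟨δ, hδ, hwδ⟩ := Metric.uniformContinuousOn_iff.1
    (isCompact_Icc.uniformContinuousOn_of_continuous (hwc.continuousOn (s := Set.Icc 0 T)))
    (η / (S + 1)) (by positivity)
  obtain ⟨n, hn⟩ := exists_nat_gt (max (T / δ) (max (2 * K * T) 0))
  simp only [max_lt_iff] at hn
  obtain ⟨hnδ, hnK, hn0⟩ := hn
  have hnpos : 0 < n := by exact_mod_cast hn0
  set h : ℝ := T / n with hh
  have hhpos : 0 < h := by positivity
  have hnh : n * h = T := by rw [hh]; field_simp
  have hhδ : h < δ := by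
    rw [div_lt_iff₀ hδ] at hnδ
    rw [hh, div_lt_iff₀ hn0]
    linarith
  have hhK : 2 * K * h ≤ 1 := by
    rw [hh, ← mul_div_assoc, div_le_one hn0]
    exact hnK.le
  let f : ℝ → EuclideanSpace ℝ (Fin d) :=
    fun t => (fun k : ℕ => w (k * h)) (min ⌊t / h⌋₊ (n - 1))
  have hstep : IsStepOn f T := hnh ▸ isStepOn_comp_floor (fun k : ℕ => w (k * h)) hhpos hnpos
  have hnode : ∀ t, ((min ⌊t / h⌋₊ (n - 1) : ℕ) : ℝ) * h ∈ Set.Icc 0 T := fun t => by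
    refine ⟨by positivity, ?_⟩
    rw [← hnh]
    gcongr
    omega
  have hfM : ∀ t, ‖f t‖ ≤ M := fun t => hM _ (hnode t)
  have hfw : ∀ t ∈ Set.Ico 0 T, ‖f t - w t‖ ≤ η / (S + 1) := fun t ht => by
    rw [← dist_eq_norm]
    refine (hwδ _ (hnode t) t ⟨ht.1, ht.2.le⟩ ?_).le
    have h0 : 0 ≤ t / h := div_nonneg ht.1 hhpos.le
    have h1 : ⌊t / h⌋₊ < n := by
      rw [Nat.floor_lt h0, div_lt_iff₀ hhpos, hnh]
      exact ht.2
    have h2 := (le_div_iff₀ hhpos).1 (Nat.floor_le h0)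
    have h3 := (div_lt_iff₀ hhpos).1 (Nat.lt_floor_add_one (t / h))
    rw [min_eq_left (by omega), Real.dist_eq, abs_lt]
    constructor <;> linarith
  have hfmeas : Measurable f :=
    (measurable_from_nat (f := fun k : ℕ => w ((min k (n - 1) : ℕ) * h))).comp
      (Nat.measurable_floor.comp (measurable_id.div_const h))
  let F : ℝ → EuclideanSpace ℝ (Fin m) → EuclideanSpace ℝ (Fin m) :=
    fun t z => btilde z + σ z (f t)
  have hF : ∀ t, LipschitzWith K (F t) := fun t => by
    refine hb.add (LipschitzWith.of_dist_le_mul fun u v => ?_)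
    rw [dist_eq_norm, ← sub_apply]
    calc ‖(σ u - σ v) (f t)‖ ≤ ‖σ u - σ v‖ * ‖f t‖ := ContinuousLinearMap.le_opNorm _ _
      _ ≤ (Kσ * dist u v) * M := by
        gcongr
        · rw [← dist_eq_norm]
          exact hσ.dist_le_mul u v
        · exact hfM t
      _ = _ := by
        push_cast
        rw [Real.coe_toNNReal _ hM0]
        ring
  obtain ⟨φ, hφ0, hφc, hφd⟩ := exists_hasDerivWithinAt_Ici_of_piecewise_const hF hhpos.le hhK
    (fun k t ht => by
      have h1 : ⌊t / h⌋₊ = k := by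
        rw [Nat.floor_eq_iff
          (div_nonneg ((by positivity : (0 : ℝ) ≤ k * h).trans ht.1) hhpos.le)]
        exact ⟨(le_div_iff₀ hhpos).2 ht.1, (div_lt_iff₀ hhpos).2 ht.2⟩
      simp [F, f, h1, hhpos.ne']) x n
  rw [hnh] at hφc hφd
  refine ⟨f, hstep, φ, hφc, fun t ht => ?_, fun t ht => ?_⟩
  · have hφc' : ContinuousOn φ (Set.Icc 0 t) := hφc.mono (Set.Icc_subset_Icc_right ht.2)
    have hint : IntervalIntegrable (fun s => btilde (φ s) + σ (φ s) (f s)) volume 0 t := by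
      rw [intervalIntegrable_iff_integrableOn_Icc_of_le ht.1]
      have hσφ := hσ.continuous.comp_continuousOn hφc'
      refine (hb.continuous.comp_continuousOn hφc').integrableOn_Icc.add ?_
      refine Integrable.mono' ((hσφ.norm.mul continuousOn_const).integrableOn_Icc
        (f := fun s => ‖σ (φ s)‖ * M)) ?_ (Filter.Eventually.of_forall fun s => ?_)
      · exact (ContinuousLinearMap.id ℝ _).aestronglyMeasurable_comp₂
          (hσφ.aestronglyMeasurable measurableSet_Icc) hfmeas.aestronglyMeasurable
      · exact (ContinuousLinearMap.le_opNorm _ _).trans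
          (mul_le_mul_of_nonneg_left (hfM s) (norm_nonneg _))
    rw [intervalIntegral.integral_eq_sub_of_hasDeriv_right_of_le ht.1 hφc'
      (fun s hs => (hφd s ⟨hs.1.le, hs.2.trans_le ht.2⟩).mono Set.Ioi_subset_Ici_self) hint,
      hφ0, add_sub_cancel]
  · have hG := dist_le_of_approx_trajectories_ODE (εf := 0) (εg := η) (δ := 0) hF hφc hφd
      (fun s _ => (dist_self _).le) hℓc.continuousOn
      (fun s _ => (hℓd s).hasDerivWithinAt) (fun s hs => ?_) (by simp [hφ0, ℓ]) t ht
    · rw [← dist_eq_norm]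
      refine hG.trans_lt (lt_of_le_of_lt ?_ hηε)
      rw [zero_add, sub_zero]
      exact gronwallBound_mono le_rfl hη.le K.2 ht.2
    · have h1 : T⁻¹ • (y - x) - F s (ℓ s) = -(σ (ℓ s) (f s - w s)) := by
        have h2 := hw s
        simp only [Function.comp_apply] at h2
        rw [map_sub, h2]
        simp only [F]
        abel
      rw [dist_eq_norm, h1, norm_neg]
      calc ‖σ (ℓ s) (f s - w s)‖ ≤ ‖σ (ℓ s)‖ * ‖f s - w s‖ := ContinuousLinearMap.le_opNorm _ _
        _ ≤ S * (η / (S + 1)) := by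
          gcongr
          · exact hS s ⟨hs.1, hs.2.le⟩
          · exact hfw s hs
        _ ≤ η := by
          rw [← mul_div_assoc, div_le_iff₀ (by positivity)]
          nlinarith
end
end

section
/- For α₁, …, α_d ∈ (0,2), let μ = Σ_{i=1}^d (T_i)_* ν_{α_i} be the cylindrical Lévy measure on ℝ^d. Then μ satisfies the cone condition with θ = 1/(2√d): for every ℓ ∈ ℝ^d with |ℓ| = 1 and every ε > 0, μ({u : u·ℓ ≥ (1/(2√d)) |u|} ∩ {u : 0 < |u| < ε}) > 0. -/
open MeasureTheory
open scoped RealInnerProductSpace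

noncomputable section

/-- The symmetric α-stable Lévy measure on ℝ: density `|z|^(-1-α)` w.r.t. Lebesgue
measure (the density vanishes at `z = 0` by the convention `0 ^ (-1-α) = 0`). -/
def stableMeasure (α : ℝ) : Measure ℝ :=
  volume.withDensity fun z => ENNReal.ofReal (|z| ^ (-(1 + α)))

/-- The cylindrical Lévy measure `μ = Σ_i (T_i)_* ν_{α_i}` on ℝ^d, where
`T_i z = z • e_i`. -/
def cylindricalMeasure (d : ℕ) (α : Fin d → ℝ) : Measure (EuclideanSpace ℝ (Fin d)) :=
  ∑ i : Fin d, Measure.map (fun z : ℝ => EuclideanSpace.single i z) (stableMeasure (α i))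

/-- A set of positive Lebesgue measure that avoids the origin is charged by `stableMeasure`. -/
theorem stableMeasure_pos (α : ℝ) {s : Set ℝ} (hs : 0 < volume s) (h0 : (0 : ℝ) ∉ s) :
    0 < stableMeasure α s := by
  have hf : Measurable fun z : ℝ => ENNReal.ofReal (|z| ^ (-(1 + α))) := by fun_prop
  rw [pos_iff_ne_zero, stableMeasure, Ne, withDensity_apply_eq_zero hf]
  intro h
  refine hs.ne' (measure_mono_null (fun z hz => ?_) h)
  have hz0 : z ≠ 0 := fun h => h0 (h ▸ hz)
  refine ⟨?_, hz⟩
  exact (ENNReal.ofReal_pos.2 (Real.rpow_pos_of_pos (abs_pos.2 hz0) _)).ne'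

theorem map_single_stableMeasure_le_cylindricalMeasure {d : ℕ} (α : Fin d → ℝ) (i : Fin d)
    (s : Set (EuclideanSpace ℝ (Fin d))) :
    stableMeasure (α i) ((fun z : ℝ => EuclideanSpace.single i z) ⁻¹' s)
      ≤ cylindricalMeasure d α s := by
  have hm : Measurable fun z : ℝ => EuclideanSpace.single i z :=
    (Isometry.of_dist_eq fun a b => by simp).continuous.measurable
  rw [cylindricalMeasure, Measure.finsetSum_apply]
  exact (Measure.le_map_apply hm.aemeasurable s).trans
    (Finset.single_le_sum (f := fun j => Measure.map (fun z : ℝ => EuclideanSpace.single j z)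
      (stableMeasure (α j)) s) (fun _ _ => zero_le) (Finset.mem_univ i))

/-- Some coordinate of a unit vector of `ℝ^d` has absolute value at least `1 / √d`. -/
theorem exists_one_div_sqrt_le_abs {d : ℕ} {x : EuclideanSpace ℝ (Fin d)} (hx : ‖x‖ = 1) :
    ∃ i, 1 / Real.sqrt d ≤ |x i| := by
  have hsum : ∑ i, x i ^ 2 = 1 := by rw [← EuclideanSpace.real_norm_sq_eq, hx, one_pow]
  have hd : d ≠ 0 := by
    rintro rfl
    simp at hsum
  have : Nonempty (Fin d) := Fin.pos_iff_nonempty.1 (Nat.pos_of_ne_zero hd)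
  by_contra! h
  have hlt : ∑ i, x i ^ 2 < ∑ _i : Fin d, (1 / Real.sqrt d) ^ 2 :=
    Finset.sum_lt_sum_of_nonempty Finset.univ_nonempty fun i _ =>
      sq_lt_sq' (neg_lt_of_abs_lt (h i)) (lt_of_abs_lt (h i))
  rw [hsum] at hlt
  simp [hd] at hlt

theorem statement_13 {d : ℕ} (α : Fin d → ℝ) (hα : ∀ i, α i ∈ Set.Ioo (0 : ℝ) 2) :
    ∀ ℓ : EuclideanSpace ℝ (Fin d), ‖ℓ‖ = 1 → ∀ ε > (0 : ℝ),
      0 < cylindricalMeasure d α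
        ({u | (1 / (2 * Real.sqrt d)) * ‖u‖ ≤ ⟪u, ℓ⟫} ∩ {u | 0 < ‖u‖ ∧ ‖u‖ < ε}) := by
  intro ℓ hℓ ε hε
  obtain ⟨i, hi⟩ := exists_one_div_sqrt_le_abs hℓ
  have hle : 1 / (2 * Real.sqrt d) ≤ |ℓ i| := by
    refine le_trans ?_ hi
    rw [← one_div_mul_one_div]
    nlinarith [one_div_nonneg.2 (Real.sqrt_nonneg d)]
  refine lt_of_lt_of_le ?_ (map_single_stableMeasure_le_cylindricalMeasure α i _)
  obtain hpos | hneg := le_total 0 (ℓ i)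
  · refine (stableMeasure_pos (α i) (s := Set.Ioo 0 ε) (by simpa using hε) (by simp)).trans_le
      (measure_mono fun z hz => ?_)
    rw [abs_of_nonneg hpos] at hle
    simpa [EuclideanSpace.inner_single_left, abs_of_pos hz.1, hz.1.ne', hz.2, mul_comm z]
      using mul_le_mul_of_nonneg_right hle hz.1.le
  · refine (stableMeasure_pos (α i) (s := Set.Ioo (-ε) 0) (by simpa using hε) (by simp)).trans_le
      (measure_mono fun z hz => ?_)
    rw [abs_of_nonpos hneg] at hle
    simpa [EuclideanSpace.inner_single_left, abs_of_neg hz.2, hz.2.ne, neg_lt.1 hz.1, mul_comm z]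
      using mul_le_mul_of_nonneg_right hle (neg_nonneg.2 hz.2.le)
end
end

section
/- Let α ∈ (1,2) and γ ∈ (1, α], and let μ be the pushforward of ν_α under the map z ↦ (z, |z|^γ sgn z) from ℝ to ℝ². Then for every nonzero ℓ ∈ ℝ², ∫_{|u| ≤ 1} |u·ℓ| μ(du) = ∞; that is, the integrability subspace L = {ℓ ∈ ℝ² : ∫_{|u|≤1} |u·ℓ| μ(du) < ∞} equals {0}. -/
open MeasureTheory
open scoped RealInnerProductSpace

noncomputable section

/-- The pushforward of the α-stable Lévy measure under `z ↦ (z, |z|^γ sgn z) ∈ ℝ²`. -/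
def curveMeasure (α γ : ℝ) : Measure (EuclideanSpace ℝ (Fin 2)) :=
  Measure.map
    (fun z : ℝ =>
      EuclideanSpace.single (0 : Fin 2) z +
        EuclideanSpace.single (1 : Fin 2) (|z| ^ γ * Real.sign z))
    (stableMeasure α)

/-- The curve `z ↦ (z, |z|^γ sgn z)` is Borel measurable. -/
theorem measurable_signedPowerCurve (γ : ℝ) :
    Measurable (fun z : ℝ =>
      EuclideanSpace.single (0 : Fin 2) z +
        EuclideanSpace.single (1 : Fin 2) (|z| ^ γ * Real.sign z)) := by
  have hsign : Measurable Real.sign := by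
    have h : Real.sign = fun r : ℝ => if r < 0 then (-1 : ℝ) else if 0 < r then 1 else 0 := by
      funext r
      rfl
    rw [h]
    exact Measurable.ite measurableSet_Iio measurable_const
      (Measurable.ite measurableSet_Ioi measurable_const measurable_const)
  have hsingle : ∀ i : Fin 2, Measurable fun x : ℝ => EuclideanSpace.single i x := by
    intro i
    have h : Isometry fun x : ℝ => EuclideanSpace.single i x :=
      Isometry.of_dist_eq fun x y => by simp
    exact h.continuous.measurable
  have hpow : Measurable fun z : ℝ => |z| ^ γ * Real.sign z := by fun_prop
  exact (hsingle 0).add ((hsingle 1).comp hpow)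

/-- Near `0⁺` a nontrivial combination `a z + b z^γ` with `γ > 1` is at least of order `z^γ`. -/
theorem exists_eventually_mul_rpow_le_abs_add {a b γ : ℝ} (hab : a ≠ 0 ∨ b ≠ 0) (hγ : 1 < γ) :
    ∃ c > 0, ∃ δ > 0, ∀ z ∈ Set.Ioo 0 δ, c * z ^ γ ≤ |z * a + z ^ γ * b| := by
  by_cases ha : a = 0
  · subst ha
    refine ⟨|b|, by simpa using hab, 1, one_pos, fun z hz => ?_⟩
    have := Real.rpow_nonneg hz.1.le γ
    simp [abs_mul, abs_of_nonneg this, mul_comm]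
  · have hlim : Filter.Tendsto (fun z : ℝ => |a + z ^ (γ - 1) * b|) (nhds 0) (nhds |a|) := by
      have h : ContinuousAt (fun z : ℝ => |a + z ^ (γ - 1) * b|) 0 :=
        (continuousAt_const.add ((Real.continuousAt_rpow_const 0 (γ - 1)
          (Or.inr (by linarith))).mul continuousAt_const)).abs
      simpa [ContinuousAt, Real.zero_rpow (by linarith : γ - 1 ≠ 0)] using h
    have hpos : 0 < |a| := abs_pos.mpr ha
    obtain ⟨ε, hε, h⟩ := Metric.eventually_nhds_iff.mp
      (hlim.eventually (lt_mem_nhds (half_lt_self hpos)))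
    refine ⟨|a| / 2, half_pos hpos, min ε 1, lt_min hε one_pos, fun z hz => ?_⟩
    have hz0 := hz.1
    have hzε : z < ε := hz.2.trans_le (min_le_left _ _)
    have hz1 : z ≤ 1 := hz.2.le.trans (min_le_right _ _)
    have h1 : |a| / 2 < |a + z ^ (γ - 1) * b| :=
      h (by simpa [abs_of_pos hz0] using hzε)
    have hsplit : z ^ γ = z * z ^ (γ - 1) := by
      rw [← Real.rpow_one_add' hz0.le (by linarith)]
      ring_nf
    have hle : z ^ γ ≤ z := by
      simpa using Real.rpow_le_rpow_of_exponent_ge hz0 hz1 hγ.le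
    calc |a| / 2 * z ^ γ ≤ |a| / 2 * z := by gcongr
      _ ≤ |a + z ^ (γ - 1) * b| * z := by gcongr
      _ = |z * a + z ^ γ * b| := by
        rw [hsplit, ← abs_of_pos hz0, ← abs_mul, abs_of_pos hz0]
        ring_nf

/-- `z ↦ c / z` has infinite integral at `0⁺`. -/
theorem lintegral_Ioo_ofReal_mul_inv_eq_top {c δ : ℝ} (hc : 0 < c) (hδ : 0 < δ) :
    ∫⁻ z in Set.Ioo 0 δ, ENNReal.ofReal (c * z ^ (-1 : ℝ)) = ⊤ := by
  by_contra h
  have hnn : 0 ≤ᵐ[volume.restrict (Set.Ioo 0 δ)] fun z : ℝ => c * z ^ (-1 : ℝ) := by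
    filter_upwards [ae_restrict_mem measurableSet_Ioo] with z hz
    exact mul_nonneg hc.le (Real.rpow_nonneg hz.1.le _)
  have hm : Measurable fun z : ℝ => c * z ^ (-1 : ℝ) := by fun_prop
  have hmul := (lintegral_ofReal_ne_top_iff_integrable hm.aestronglyMeasurable hnn).mp h
  have hinv : IntegrableOn (fun z : ℝ => z ^ (-1 : ℝ)) (Set.Ioo 0 δ) := by
    have := hmul.const_mul c⁻¹
    simpa [IntegrableOn, inv_mul_cancel_left₀ hc.ne'] using this
  exact lt_irrefl _ ((intervalIntegral.integrableOn_Ioo_rpow_iff hδ).mp hinv)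

/-- Every nonzero linear functional has infinite truncated first moment under `curveMeasure`. -/
theorem lintegral_abs_inner_curveMeasure_eq_top {α γ : ℝ} (hγ : γ ∈ Set.Ioc (1 : ℝ) α)
    {ℓ : EuclideanSpace ℝ (Fin 2)} (hℓ : ℓ ≠ 0) :
    ∫⁻ u in {u | ‖u‖ ≤ 1}, ENNReal.ofReal |⟪u, ℓ⟫| ∂(curveMeasure α γ) = ⊤ := by
  have hab : ℓ 0 ≠ 0 ∨ ℓ 1 ≠ 0 := by
    by_contra! h
    exact hℓ (by ext i; fin_cases i <;> simp [h.1, h.2])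
  obtain ⟨c, hc, δ, hδ, hbound⟩ := exists_eventually_mul_rpow_le_abs_add hab hγ.1
  have hball : MeasurableSet {u : EuclideanSpace ℝ (Fin 2) | ‖u‖ ≤ 1} :=
    measurableSet_le measurable_norm measurable_const
  have hcurve := measurable_signedPowerCurve γ
  have hdens : Measurable fun z : ℝ => ENNReal.ofReal (|z| ^ (-(1 + α))) := by fun_prop
  have hinner : Measurable fun u : EuclideanSpace ℝ (Fin 2) => ENNReal.ofReal |⟪u, ℓ⟫| := by
    fun_prop
  have hcomp : Measurable fun z : ℝ => ENNReal.ofReal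
      |⟪EuclideanSpace.single (0 : Fin 2) z +
        EuclideanSpace.single (1 : Fin 2) (|z| ^ γ * Real.sign z), ℓ⟫| := hinner.comp hcurve
  rw [curveMeasure, setLIntegral_map hball hinner hcurve, stableMeasure,
    setLIntegral_withDensity_eq_setLIntegral_mul _ hdens hcomp (hcurve hball),
    eq_top_iff, ← lintegral_Ioo_ofReal_mul_inv_eq_top hc (lt_min hδ (half_pos one_pos))]
  refine (setLIntegral_mono_ae' measurableSet_Ioo (ae_of_all _ fun z hz => ?_)).trans
    (lintegral_mono_set fun z hz => ?_)
  · have hz0 := hz.1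
    have hzδ : z < δ := hz.2.trans_le (min_le_left _ _)
    have hz1 : z ≤ 1 := by
      have := hz.2.trans_le (min_le_right _ _)
      linarith
    simp only [Pi.mul_apply]
    rw [← ENNReal.ofReal_mul (by positivity)]
    apply ENNReal.ofReal_le_ofReal
    have hval : ⟪EuclideanSpace.single (0 : Fin 2) z +
        EuclideanSpace.single (1 : Fin 2) (|z| ^ γ * Real.sign z), ℓ⟫ =
          z * ℓ 0 + z ^ γ * ℓ 1 := by
      simp [inner_add_left, EuclideanSpace.inner_single_left, abs_of_pos hz0,
        Real.sign_of_pos hz0]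
    rw [hval, abs_of_pos hz0]
    calc c * z ^ (-1 : ℝ) ≤ c * z ^ (-(1 + α) + γ) := by
          gcongr ?_ * ?_
          exact Real.rpow_le_rpow_of_exponent_ge hz0 hz1 (by linarith [hγ.2])
      _ = z ^ (-(1 + α)) * (c * z ^ γ) := by
          rw [Real.rpow_add hz0]
          ring
      _ ≤ z ^ (-(1 + α)) * |z * ℓ 0 + z ^ γ * ℓ 1| := by
          gcongr
          exact hbound z ⟨hz0, hzδ⟩
  · have hz0 := hz.1
    have hz2 : z ≤ 1 / 2 := (hz.2.trans_le (min_le_right _ _)).le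
    have hle : z ^ γ ≤ z := by
      simpa using Real.rpow_le_rpow_of_exponent_ge hz0 (by linarith) hγ.1.le
    refine (norm_add_le _ _).trans ?_
    simp only [PiLp.norm_single, abs_of_pos hz0, Real.sign_of_pos hz0, mul_one,
      Real.norm_eq_abs, abs_of_pos (Real.rpow_pos_of_pos hz0 γ)]
    linarith

theorem statement_14 (α γ : ℝ) (hα : α ∈ Set.Ioo (1 : ℝ) 2) (hγ : γ ∈ Set.Ioc (1 : ℝ) α) :
    (∀ ℓ : EuclideanSpace ℝ (Fin 2), ℓ ≠ 0 →
      ∫⁻ u in {u | ‖u‖ ≤ 1}, ENNReal.ofReal |⟪u, ℓ⟫| ∂(curveMeasure α γ) = ⊤) ∧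
    {ℓ : EuclideanSpace ℝ (Fin 2) |
        IntegrableOn (fun u => |⟪u, ℓ⟫|) {u | ‖u‖ ≤ 1} (curveMeasure α γ)} = {0} := by
  refine ⟨fun ℓ hℓ => lintegral_abs_inner_curveMeasure_eq_top hγ hℓ, ?_⟩
  ext ℓ
  simp only [Set.mem_ofPred_eq, Set.mem_singleton_iff]
  constructor
  · intro h
    by_contra hℓ
    exact h.lintegral_lt_top.ne (lintegral_abs_inner_curveMeasure_eq_top hγ hℓ)
  · rintro rfl
    simp
end
end
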